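/- arXiv:2302.13103 — 2 statements merged into one kernel-verified Lean document; each statement's English description precedes it below -/
import Mathlib

section
/- Let V = ⊕_{j=1}^r V_j and Y = ⊕_{j=1}^r Y_j be complex-valued (d₁,…,d_r) separable Γ-periodic potentials that are Floquet isospectral. Then there exist constants c₁,…,c_r ∈ ℂ with c₁ + ⋯ + c_r = 0 such that for each j = 1,…,r the lower-dimensional potentials V_j and Y_j + c_j are Floquet isospectral (as periodic potentials on W_j, with Floquet isospectrality defined exactly as in dimension d but with d replaced by d_j and the periods replaced by the q_b with b in the j-th block). -/
open scoped BigOperators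

noncomputable section

namespace DPSO

/-- The Floquet matrix `𝒟_V(z)` of the discrete periodic Schrödinger operator, indexed by the
fundamental domain `W = ∏ i, ZMod (q i)`. -/
def floquetMat {d : ℕ} (q : Fin d → ℕ) [∀ i, NeZero (q i)]
    (V : (∀ i, ZMod (q i)) → ℂ) (z : Fin d → ℂ) :
    Matrix (∀ i, ZMod (q i)) (∀ i, ZMod (q i)) ℂ :=
  fun n n' =>
    (∑ j : Fin d,
      ((if n' = n + Pi.single j 1 then (if (n j).val = q j - 1 then z j else 1) else 0)
        + (if n' = n - Pi.single j 1 then (if (n j).val = 0 then (z j)⁻¹ else 1) else 0)))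
    + (if n' = n then V n else 0)

/-- Two `Γ`-periodic potentials are Floquet isospectral if for every real quasimomentum `k`
the Floquet matrices have the same characteristic polynomial. -/
def FloquetIso {d : ℕ} (q : Fin d → ℕ) [∀ i, NeZero (q i)]
    (V Y : (∀ i, ZMod (q i)) → ℂ) : Prop :=
  ∀ k : Fin d → ℝ,
    (floquetMat q V (fun j => Complex.exp (2 * Real.pi * Complex.I * (k j)))).charpoly
      = (floquetMat q Y (fun j => Complex.exp (2 * Real.pi * Complex.I * (k j)))).charpoly

/-- Two `Γ`-periodic potentials are Fermi isospectral if for some `λ₀` their Fermi surfaces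
(inside `(ℂ∖{0})^d`) coincide. -/
def FermiIso {d : ℕ} (q : Fin d → ℕ) [∀ i, NeZero (q i)]
    (V Y : (∀ i, ZMod (q i)) → ℂ) : Prop :=
  ∃ lam : ℂ,
    {z : Fin d → ℂ | (∀ j, z j ≠ 0) ∧ (floquetMat q V z - lam • 1).det = 0}
      = {z : Fin d → ℂ | (∀ j, z j ≠ 0) ∧ (floquetMat q Y z - lam • 1).det = 0}

/-- The offset (start index) of the `j`-th consecutive block of sizes `ds 0, …, ds (r-1)`. -/
def blockOffset {r : ℕ} (ds : Fin r → ℕ) (j : Fin r) : ℕ :=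
  ∑ m ∈ Finset.univ.filter (fun m => m < j), ds m

lemma blockOffset_add_le {r : ℕ} (ds : Fin r → ℕ) (j : Fin r) :
    blockOffset ds j + ds j ≤ ∑ m, ds m := by
  have hj : j ∉ Finset.univ.filter (fun m : Fin r => m < j) := by simp
  have h : blockOffset ds j + ds j
      = ∑ m ∈ insert j (Finset.univ.filter (fun m : Fin r => m < j)), ds m := by
    rw [Finset.sum_insert hj, Nat.add_comm, blockOffset]
  rw [h]
  exact Finset.sum_le_sum_of_subset (Finset.subset_univ _)

/-- The embedding of the index set of the `j`-th block into `Fin d`. -/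
def blockEmb {d r : ℕ} (ds : Fin r → ℕ) (hsum : ∑ m, ds m = d) (j : Fin r)
    (b : Fin (ds j)) : Fin d :=
  ⟨blockOffset ds j + b.val, by
    have h1 := blockOffset_add_le ds j
    have h2 := b.isLt
    omega⟩

/-- `V` is `(d₁,…,d_r)` separable: it is a sum of functions, the `j`-th of which depends only
on the coordinates in the `j`-th block. -/
def IsSeparable {d r : ℕ} (q : Fin d → ℕ) (ds : Fin r → ℕ) (hsum : ∑ m, ds m = d)
    (V : (∀ i, ZMod (q i)) → ℂ) : Prop :=
  ∃ F : ∀ j : Fin r, ((∀ b : Fin (ds j), ZMod (q (blockEmb ds hsum j b))) → ℂ),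
    ∀ n, V n = ∑ j, F j (fun b => n (blockEmb ds hsum j b))

/-- The discrete Fourier transform of `V`. -/
def dft {d : ℕ} (q : Fin d → ℕ) [∀ i, NeZero (q i)] (V : (∀ i, ZMod (q i)) → ℂ)
    (l : ∀ i, ZMod (q i)) : ℂ :=
  (1 / ∏ i, (q i : ℂ)) * ∑ n : ∀ i, ZMod (q i), V n *
    Complex.exp (-(2 * Real.pi * Complex.I) *
      ∑ j, ((l j).val : ℂ) * ((n j).val : ℂ) / (q j : ℂ))

/-- `ρ^j_m = e^{2πi m/q_j}`. -/
def rho {d : ℕ} (q : Fin d → ℕ) (j : Fin d) (m : ℕ) : ℂ :=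
  Complex.exp (2 * Real.pi * Complex.I * (m : ℂ) / (q j : ℂ))

/-- The average `[V]` of a potential. -/
def avg {d : ℕ} (q : Fin d → ℕ) [∀ i, NeZero (q i)] (V : (∀ i, ZMod (q i)) → ℂ) : ℂ :=
  (1 / ∏ i, (q i : ℂ)) * ∑ n, V n

/-- The diagonal matrix `A(z)`. -/
def diagA {d : ℕ} (q : Fin d → ℕ) [∀ i, NeZero (q i)] (z : Fin d → ℂ) :
    Matrix (∀ i, ZMod (q i)) (∀ i, ZMod (q i)) ℂ :=
  Matrix.diagonal (fun n => ∑ j, (rho q j ((n j).val) * z j + (rho q j ((n j).val) * z j)⁻¹))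

/-- The matrix `B_V` with entries `V̂(n - n')`. -/
def matB {d : ℕ} (q : Fin d → ℕ) [∀ i, NeZero (q i)] (V : (∀ i, ZMod (q i)) → ℂ) :
    Matrix (∀ i, ZMod (q i)) (∀ i, ZMod (q i)) ℂ :=
  fun n n' => dft q V (n - n')


open Matrix Filter Topology
open scoped Kronecker

section LinearAlgebra

variable {α β : Type*} [Fintype α] [DecidableEq α] [Fintype β] [DecidableEq β]

/-- Conjugating the second factor of a Kronecker sum leaves its characteristic polynomial
unchanged. -/
lemma charpoly_kroneckerSum_conj (P : Matrix α α ℂ) (M L R : Matrix β β ℂ) (hLR : L * R = 1) :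
    (P ⊗ₖ (1 : Matrix β β ℂ) + (1 : Matrix α α ℂ) ⊗ₖ (L * M * R)).charpoly
      = (P ⊗ₖ (1 : Matrix β β ℂ) + (1 : Matrix α α ℂ) ⊗ₖ M).charpoly := by
  have hRL : R * L = 1 := mul_eq_one_comm.mp hLR
  have h : P ⊗ₖ (1 : Matrix β β ℂ) + (1 : Matrix α α ℂ) ⊗ₖ (L * M * R)
      = ((1 : Matrix α α ℂ) ⊗ₖ L) *
        ((P ⊗ₖ (1 : Matrix β β ℂ) + (1 : Matrix α α ℂ) ⊗ₖ M) * ((1 : Matrix α α ℂ) ⊗ₖ R)) := by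
    simp only [add_mul, mul_add, ← mul_kronecker_mul, one_mul, mul_one, hLR, mul_assoc]
  rw [h, charpoly_mul_comm, mul_assoc, ← mul_kronecker_mul, hRL, one_mul, one_kronecker_one,
    mul_one]

/-- Rescaled characteristic matrix of the Kronecker sum of `P` and `diag(u a + u⁻¹ b) + K`. -/
def rescaledCharMatrix (a b : β → ℂ) (k₀ : β) (P : Matrix α α ℂ) (K : Matrix β β ℂ)
    (x u : ℂ) : Matrix (α × β) (α × β) ℂ :=
  diagonal (fun p : α × β => if p.2 = k₀ then 1 else u⁻¹) *
    (scalar (α × β) (x + u * a k₀) - (P ⊗ₖ (1 : Matrix β β ℂ) +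
      (1 : Matrix α α ℂ) ⊗ₖ (diagonal (fun k => u * a k + u⁻¹ * b k) + K)))

/-- Entrywise limit of `rescaledCharMatrix` as `u → ∞`. -/
def limitCharMatrix (a : β → ℂ) (k₀ : β) (P : Matrix α α ℂ) (K : Matrix β β ℂ)
    (x : ℂ) : Matrix (α × β) (α × β) ℂ :=
  fun p s => if p.2 = k₀ then
      (if s.2 = k₀ then (scalar α x - P) p.1 s.1 else 0) - (if p.1 = s.1 then K k₀ s.2 else 0)
    else if p = s then a k₀ - a p.2 else 0

lemma tendsto_rescaledCharMatrix (a b : β → ℂ) (k₀ : β) (P : Matrix α α ℂ) (K : Matrix β β ℂ)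
    (x : ℂ) :
    Tendsto (fun t : ℝ => rescaledCharMatrix a b k₀ P K x t) atTop
      (𝓝 (limitCharMatrix a k₀ P K x)) := by
  have hinv : Tendsto (fun t : ℝ => ((t : ℂ))⁻¹) atTop (𝓝 0) := by
    have := (Complex.continuous_ofReal.tendsto 0).comp tendsto_inv_atTop_zero
    simpa [Function.comp_def] using this
  refine tendsto_pi_nhds.mpr fun p => tendsto_pi_nhds.mpr fun s => ?_
  obtain ⟨i, k⟩ := p
  obtain ⟨j, l⟩ := s
  by_cases hk : k = k₀
  · subst hk
    have h : ∀ t : ℝ, rescaledCharMatrix a b k P K x t (i, k) (j, l)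
        = limitCharMatrix a k P K x (i, k) (j, l)
          - (if (i, k) = (j, l) then b k else 0) * (t : ℂ)⁻¹ := by
      intro t
      by_cases hij : i = j <;> by_cases hkl : k = l
      all_goals
        try subst hij
        try subst hkl
        simp [rescaledCharMatrix, limitCharMatrix, diagonal_mul, kroneckerMap_apply, *,
          one_apply, Ne.symm, eq_comm]
      all_goals try ring
    simp_rw [h]
    simpa using (tendsto_const_nhds (x := limitCharMatrix a k P K x (i, k) (j, l))).sub
      (hinv.const_mul (if (i, k) = (j, l) then b k else 0))
  · have h : ∀ᶠ t : ℝ in atTop, limitCharMatrix a k₀ P K x (i, k) (j, l)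
          + (t : ℂ)⁻¹ * ((if (i, k) = (j, l) then x - (t : ℂ)⁻¹ * b k else 0)
            - (if k = l then P i j else 0) - (if i = j then K k l else 0))
          = rescaledCharMatrix a b k₀ P K x t (i, k) (j, l) := by
      filter_upwards [eventually_gt_atTop 0] with t ht
      have ht' : (t : ℂ) ≠ 0 := by exact_mod_cast ht.ne'
      by_cases hij : i = j <;> by_cases hkl : k = l
      all_goals
        try subst hij
        try subst hkl
        simp [rescaledCharMatrix, limitCharMatrix, diagonal_mul, kroneckerMap_apply, *,
          one_apply]
      all_goals try (field_simp; ring)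
    refine Tendsto.congr' h ?_
    have h1 : Tendsto (fun t : ℝ => (if (i, k) = (j, l) then x - (t : ℂ)⁻¹ * b k else 0)
            - (if k = l then P i j else 0) - (if i = j then K k l else 0)) atTop
        (𝓝 ((if (i, k) = (j, l) then x - 0 * b k else 0)
            - (if k = l then P i j else 0) - (if i = j then K k l else 0))) := by
      refine Tendsto.sub_const (Tendsto.sub_const ?_ _) _
      split_ifs
      · exact (hinv.mul_const _).const_sub _
      · exact tendsto_const_nhds
    simpa using (tendsto_const_nhds (x := limitCharMatrix a k₀ P K x (i, k) (j, l))).add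
      (hinv.mul h1)

lemma det_limitCharMatrix (a : β → ℂ) (k₀ : β) (P : Matrix α α ℂ) (K : Matrix β β ℂ) (x : ℂ) :
    (limitCharMatrix a k₀ P K x).det = (scalar α x - (P + scalar α (K k₀ k₀))).det *
      ∏ p : {p : α × β // ¬ p.2 = k₀}, (a k₀ - a p.1.2) := by
  rw [twoBlockTriangular_det _ (fun p => p.2 = k₀)]
  · congr 1
    · let e : α ≃ {p : α × β // p.2 = k₀} :=
        ⟨fun i => ⟨(i, k₀), rfl⟩, fun p => p.1.1, fun _ => rfl, by
          rintro ⟨⟨i, k⟩, rfl⟩; rfl⟩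
      rw [← det_submatrix_equiv_self e]
      congr 1
      ext i j
      by_cases hij : i = j
      · subst hij
        simp [limitCharMatrix, toSquareBlockProp, e, toBlock]
        ring
      · simp [limitCharMatrix, toSquareBlockProp, e, toBlock, hij]
    · rw [← det_diagonal]
      congr 1
      ext ⟨p, hp⟩ ⟨s, hs⟩
      simp [limitCharMatrix, toSquareBlockProp, toBlock, hp, diagonal_apply]
  · intro p hp s hs
    have : p ≠ s := by rintro rfl; exact hp hs
    simp [limitCharMatrix, hp, this]

/-- If the Kronecker sums of `P` with `diag(u a + u⁻¹ b) + K` and of `P'` with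
`diag(u a + u⁻¹ b) + K'` are isospectral for all `u ≠ 0`, then so are `P + K k₀ k₀` and
`P' + K' k₀ k₀`, for each index `k₀` at which the value of `a` is attained only once. -/
lemma charpoly_eq_of_kroneckerSum (a b : β → ℂ) (k₀ : β) (ha : ∀ k, k ≠ k₀ → a k ≠ a k₀)
    (P P' : Matrix α α ℂ) (K K' : Matrix β β ℂ)
    (h : ∀ u : ℂ, u ≠ 0 →
      (P ⊗ₖ (1 : Matrix β β ℂ) +
        (1 : Matrix α α ℂ) ⊗ₖ (diagonal (fun k => u * a k + u⁻¹ * b k) + K)).charpoly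
      = (P' ⊗ₖ (1 : Matrix β β ℂ) +
        (1 : Matrix α α ℂ) ⊗ₖ (diagonal (fun k => u * a k + u⁻¹ * b k) + K')).charpoly) :
    (P + scalar α (K k₀ k₀)).charpoly = (P' + scalar α (K' k₀ k₀)).charpoly := by
  refine Polynomial.funext fun x => ?_
  rw [eval_charpoly, eval_charpoly]
  have hlim (P : Matrix α α ℂ) (K : Matrix β β ℂ) :
      Tendsto (fun t : ℝ => (rescaledCharMatrix a b k₀ P K x t).det) atTop
        (𝓝 (limitCharMatrix a k₀ P K x).det) :=
    ((continuous_id.matrix_det).tendsto _).comp (tendsto_rescaledCharMatrix a b k₀ P K x)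
  have heq : (fun t : ℝ => (rescaledCharMatrix a b k₀ P K x t).det)
      =ᶠ[atTop] fun t : ℝ => (rescaledCharMatrix a b k₀ P' K' x t).det := by
    filter_upwards [eventually_gt_atTop 0] with t ht
    have ht' : (t : ℂ) ≠ 0 := by exact_mod_cast ht.ne'
    simp only [rescaledCharMatrix, det_mul, ← eval_charpoly, h t ht']
  have := tendsto_nhds_unique ((hlim P K).congr' heq) (hlim P' K')
  rw [det_limitCharMatrix, det_limitCharMatrix] at this
  refine mul_right_cancel₀ ?_ this
  exact Finset.prod_ne_zero_iff.mpr fun p _ => sub_ne_zero.mpr (ha _ p.2).symm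

end LinearAlgebra

section ZModTwist

lemma zmod_val_add_one (m : ℕ) [NeZero m] (a : ZMod m) : (a + 1).val = (a.val + 1) % m := by
  rw [ZMod.val_add, ZMod.val_one_eq_one_mod, Nat.add_mod_mod]

lemma zmod_twist_add_one (m : ℕ) [NeZero m] (a : ZMod m) (u : ℂ) :
    (if a.val = m - 1 then u ^ m else 1) * u ^ (a + 1).val = u * u ^ a.val := by
  have hm := NeZero.pos m
  have ha := a.val_lt
  rw [zmod_val_add_one]
  split_ifs with h
  · rw [h, Nat.sub_add_cancel hm, Nat.mod_self, pow_zero, mul_one, ← pow_succ',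
      Nat.sub_add_cancel hm]
  · rw [Nat.mod_eq_of_lt (by omega), pow_succ', one_mul]

lemma zmod_twist_sub_one (m : ℕ) [NeZero m] (a : ZMod m) {u : ℂ} (hu : u ≠ 0) :
    (if a.val = 0 then (u ^ m)⁻¹ else 1) * u ^ (a - 1).val = u⁻¹ * u ^ a.val := by
  obtain ⟨b, rfl⟩ : ∃ b, a = b + 1 := ⟨a - 1, by simp⟩
  have hm := NeZero.pos m
  have hb := b.val_lt
  have key := zmod_twist_add_one m b u
  have hiff : (b + 1).val = 0 ↔ b.val = m - 1 := by
    rw [zmod_val_add_one]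
    constructor
    · intro h
      by_contra hne
      rw [Nat.mod_eq_of_lt (by omega)] at h
      omega
    · intro h
      rw [h, Nat.sub_add_cancel hm, Nat.mod_self]
  rw [add_sub_cancel_right]
  simp only [hiff]
  split_ifs at key ⊢ with h
  · field_simp
    rw [key, mul_comm]
  · rw [one_mul] at key
    rw [key, ← mul_assoc, inv_mul_cancel₀ hu]

end ZModTwist

section Floquet

variable {κ κ' ι : Type*}

/-- Splitting coordinates into two groups identifies `W` with a product. -/
def splitEquiv (q : ι → ℕ) (f : κ ⊕ κ' ≃ ι) :
    (∀ i, ZMod (q i)) ≃ (∀ a, ZMod (q (f (Sum.inl a)))) × (∀ b, ZMod (q (f (Sum.inr b)))) :=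
  (Equiv.piCongrLeft (fun i => ZMod (q i)) f).symm.trans
    (Equiv.sumPiEquivProdPi fun s => ZMod (q (f s)))

lemma splitEquiv_apply (q : ι → ℕ) (f : κ ⊕ κ' ≃ ι) (n : ∀ i, ZMod (q i)) :
    splitEquiv q f n = (fun a => n (f (Sum.inl a)), fun b => n (f (Sum.inr b))) := rfl

lemma splitEquiv_add (q : ι → ℕ) (f : κ ⊕ κ' ≃ ι) (m n : ∀ i, ZMod (q i)) :
    splitEquiv q f (m + n) = splitEquiv q f m + splitEquiv q f n := rfl

lemma splitEquiv_sub (q : ι → ℕ) (f : κ ⊕ κ' ≃ ι) (m n : ∀ i, ZMod (q i)) :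
    splitEquiv q f (m - n) = splitEquiv q f m - splitEquiv q f n := rfl

lemma splitEquiv_single_inl [DecidableEq ι] [DecidableEq κ] (q : ι → ℕ)
    (f : κ ⊕ κ' ≃ ι) (a : κ) :
    splitEquiv q f (Pi.single (f (Sum.inl a)) 1) = (Pi.single a 1, 0) := by
  rw [splitEquiv_apply]
  ext b
  · by_cases h : b = a
    · subst h; simp
    · simp [h]
  · simp

lemma splitEquiv_single_inr [DecidableEq ι] [DecidableEq κ'] (q : ι → ℕ)
    (f : κ ⊕ κ' ≃ ι) (a : κ') :
    splitEquiv q f (Pi.single (f (Sum.inr a)) 1) = (0, Pi.single a 1) := by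
  rw [splitEquiv_apply]
  ext b
  · simp
  · by_cases h : b = a
    · subst h; simp
    · simp [h]

/-- The gauge weight `∏ u ^ nᵢ`. -/
def gauge [Fintype ι] (q : ι → ℕ) (u : ℂ) (n : ∀ i, ZMod (q i)) : ℂ := ∏ i, u ^ (n i).val

lemma gauge_ne_zero [Fintype ι] (q : ι → ℕ) {u : ℂ} (hu : u ≠ 0) (n : ∀ i, ZMod (q i)) :
    gauge q u n ≠ 0 := Finset.prod_ne_zero_iff.mpr fun _ _ => pow_ne_zero _ hu

variable [Fintype ι] [DecidableEq ι]

/-- The Floquet matrix with coordinates indexed by an arbitrary finite type. -/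
def floquetMatrix (q : ι → ℕ) [∀ i, NeZero (q i)] (V : (∀ i, ZMod (q i)) → ℂ) (z : ι → ℂ) :
    Matrix (∀ i, ZMod (q i)) (∀ i, ZMod (q i)) ℂ :=
  fun n n' =>
    (∑ j : ι,
      ((if n' = n + Pi.single j 1 then (if (n j).val = q j - 1 then z j else 1) else 0)
        + (if n' = n - Pi.single j 1 then (if (n j).val = 0 then (z j)⁻¹ else 1) else 0)))
    + (if n' = n then V n else 0)

lemma floquetMat_eq_floquetMatrix {d : ℕ} (q : Fin d → ℕ) [∀ i, NeZero (q i)]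
    (V : (∀ i, ZMod (q i)) → ℂ) (z : Fin d → ℂ) : floquetMat q V z = floquetMatrix q V z := rfl

lemma sum_floquetMatrix_mul (q : ι → ℕ) [∀ i, NeZero (q i)] (V : (∀ i, ZMod (q i)) → ℂ)
    (z : ι → ℂ) (g : (∀ i, ZMod (q i)) → ℂ) (n : ∀ i, ZMod (q i)) :
    ∑ n', floquetMatrix q V z n n' * g n' =
      (∑ j, ((if (n j).val = q j - 1 then z j else 1) * g (n + Pi.single j 1)
        + (if (n j).val = 0 then (z j)⁻¹ else 1) * g (n - Pi.single j 1))) + V n * g n := by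
  simp only [floquetMatrix, add_mul, Finset.sum_mul, Finset.sum_add_distrib, ite_mul, zero_mul]
  rw [Finset.sum_comm, Finset.sum_comm (s := Finset.univ (α := ∀ i, ZMod (q i)))]
  simp

lemma gauge_add_single (q : ι → ℕ) [∀ i, NeZero (q i)] (u : ℂ) (n : ∀ i, ZMod (q i)) (j : ι) :
    (if (n j).val = q j - 1 then u ^ q j else 1) * gauge q u (n + Pi.single j 1)
      = u * gauge q u n := by
  simp only [gauge]
  rw [Fintype.prod_eq_mul_prod_compl j, Fintype.prod_eq_mul_prod_compl j (fun i => u ^ (n i).val),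
    ← mul_assoc, ← mul_assoc, ← zmod_twist_add_one (q j) (n j) u]
  congr 1
  · simp
  · refine Finset.prod_congr rfl fun i hi => ?_
    have : i ≠ j := by simpa using hi
    simp [this]

lemma gauge_sub_single (q : ι → ℕ) [∀ i, NeZero (q i)] {u : ℂ} (hu : u ≠ 0)
    (n : ∀ i, ZMod (q i)) (j : ι) :
    (if (n j).val = 0 then (u ^ q j)⁻¹ else 1) * gauge q u (n - Pi.single j 1)
      = u⁻¹ * gauge q u n := by
  simp only [gauge]
  rw [Fintype.prod_eq_mul_prod_compl j, Fintype.prod_eq_mul_prod_compl j (fun i => u ^ (n i).val),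
    ← mul_assoc, ← mul_assoc, ← zmod_twist_sub_one (q j) (n j) hu]
  congr 1
  · simp
  · refine Finset.prod_congr rfl fun i hi => ?_
    have : i ≠ j := by simpa using hi
    simp [this]

lemma sum_floquetMatrix_mul_character (q : ι → ℕ) [∀ i, NeZero (q i)]
    (V : (∀ i, ZMod (q i)) → ℂ) {u : ℂ} (hu : u ≠ 0) (χ : AddChar (∀ i, ZMod (q i)) ℂ)
    (n : ∀ i, ZMod (q i)) :
    ∑ n', floquetMatrix q V (fun i => u ^ q i) n n' * (gauge q u n' * χ n') =
      gauge q u n * χ n *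
        (u * ∑ j, χ (Pi.single j 1) + u⁻¹ * ∑ j, χ (-Pi.single j 1) + V n) := by
  rw [sum_floquetMatrix_mul]
  simp only [← mul_assoc, gauge_add_single, gauge_sub_single q hu]
  simp only [sub_eq_add_neg, AddChar.map_add_eq_mul, Finset.sum_add_distrib, mul_add,
    Finset.mul_sum]
  congr 1
  · congr 1 <;> exact Finset.sum_congr rfl fun j _ => by ring
  · ring

/-- The matrix of multiplication by `V` in the basis of characters enumerated by `e`. -/
def potentialFourierMatrix {G : Type*} [AddCommGroup G] [Fintype G] (e : G ≃ AddChar G ℂ)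
    (V : G → ℂ) : Matrix G G ℂ :=
  fun k l => 𝔼 n, e l n * e k (-n) * V n

lemma expect_character_mul {G : Type*} [AddCommGroup G] [Fintype G] [DecidableEq G]
    (e : G ≃ AddChar G ℂ) (k l : G) :
    (𝔼 n, e l n * e k (-n)) = if k = l then 1 else 0 := by
  classical
  have := AddChar.expect_eq_ite (e l - e k)
  simp only [AddChar.sub_apply] at this
  rw [this]
  exact if_congr (sub_eq_zero.trans (e.apply_eq_iff_eq.trans eq_comm)) rfl rfl

lemma exists_conj_floquetMatrix (q : ι → ℕ) [∀ i, NeZero (q i)] (V : (∀ i, ZMod (q i)) → ℂ)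
    (e : (∀ i, ZMod (q i)) ≃ AddChar (∀ i, ZMod (q i)) ℂ) {u : ℂ} (hu : u ≠ 0) :
    ∃ L R : Matrix (∀ i, ZMod (q i)) (∀ i, ZMod (q i)) ℂ, L * R = 1 ∧
      L * floquetMatrix q V (fun i => u ^ q i) * R =
        diagonal (fun k => u * ∑ j, e k (Pi.single j 1) + u⁻¹ * ∑ j, e k (-Pi.single j 1))
          + potentialFourierMatrix e V := by
  let N : ℂ := Fintype.card (∀ i, ZMod (q i))
  refine ⟨of fun k n => N⁻¹ * ((gauge q u n)⁻¹ * e k (-n)),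
    of fun n k => gauge q u n * e k n, ?_, ?_⟩
  · ext k l
    rw [mul_apply, one_apply, ← expect_character_mul e k l, Fintype.expect_eq_sum_div_card,
      div_eq_inv_mul, Finset.mul_sum]
    refine Finset.sum_congr rfl fun n _ => ?_
    have := gauge_ne_zero q hu n
    simp only [N, of_apply]
    field_simp
  · rw [mul_assoc]
    ext k l
    rw [mul_apply]
    simp only [mul_apply, of_apply, sum_floquetMatrix_mul_character q V hu]
    rw [Matrix.add_apply, diagonal_apply, potentialFourierMatrix]
    have hd : (if k = l then
          u * ∑ j, e k (Pi.single j 1) + u⁻¹ * ∑ j, e k (-Pi.single j 1) else 0)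
        = (𝔼 n, e l n * e k (-n)) *
          (u * ∑ j, e l (Pi.single j 1) + u⁻¹ * ∑ j, e l (-Pi.single j 1)) := by
      rw [expect_character_mul]
      split_ifs with h
      · rw [h, one_mul]
      · rw [zero_mul]
    rw [hd, Finset.expect_mul, ← Finset.expect_add_distrib, Fintype.expect_eq_sum_div_card,
      Finset.sum_div]
    refine Finset.sum_congr rfl fun n _ => ?_
    have := gauge_ne_zero q hu n
    simp only [N]
    field_simp

/-- A character of `∏ ZMod (q i)` whose values on the unit vectors sum to their number is
trivial. -/
lemma character_eq_zero_of_sum_single (q : ι → ℕ) [∀ i, NeZero (q i)]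
    (χ : AddChar (∀ i, ZMod (q i)) ℂ)
    (h : ∑ j, χ (Pi.single j 1) = Fintype.card ι) : χ = 0 := by
  have hle (j : ι) : (χ (Pi.single j 1)).re ≤ 1 :=
    (Complex.re_le_norm _).trans_eq (AddChar.norm_apply χ _)
  have hsum : ∑ j, (χ (Pi.single j 1)).re = ∑ _j : ι, (1 : ℝ) := by
    rw [← Complex.re_sum, h]
    simp
  have hre := (Finset.sum_eq_sum_iff_of_le (s := Finset.univ) fun j _ => hle j).mp hsum
  have hone (j : ι) : χ (Pi.single j 1) = 1 := by
    have h1 := hre j (Finset.mem_univ j)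
    have h2 : ‖χ (Pi.single j 1)‖ = 1 := AddChar.norm_apply χ _
    have h3 := Complex.sq_norm (χ (Pi.single j 1))
    rw [h2, Complex.normSq_apply, h1] at h3
    have him : (χ (Pi.single j 1)).im = 0 := by nlinarith
    exact Complex.ext h1 him
  rw [AddChar.eq_zero_iff]
  intro n
  have hn : n = ∑ j, (n j).val • (Pi.single j 1 : ∀ i, ZMod (q i)) := by
    conv_lhs => rw [← Finset.univ_sum_single n]
    refine Finset.sum_congr rfl fun j _ => ?_
    rw [← Pi.single_smul]
    simp
  rw [hn]
  refine Finset.sum_induction (fun j => (n j).val • (Pi.single j 1 : ∀ i, ZMod (q i)))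
    (fun m => χ m = 1) (fun a b ha hb => ?_) ?_ fun j _ => ?_
  · rw [AddChar.map_add_eq_mul, ha, hb, one_mul]
  · exact χ.map_zero_eq_one
  · rw [AddChar.map_nsmul_eq_pow, hone, one_pow]

variable [Fintype κ] [DecidableEq κ] [Fintype κ'] [DecidableEq κ']

lemma reindex_floquetMatrix (q : ι → ℕ) [∀ i, NeZero (q i)] (f : κ ⊕ κ' ≃ ι)
    (V : (∀ i, ZMod (q i)) → ℂ) (V₁ : (∀ a, ZMod (q (f (Sum.inl a)))) → ℂ)
    (V₂ : (∀ b, ZMod (q (f (Sum.inr b)))) → ℂ)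
    (hV : ∀ n, V n = V₁ (splitEquiv q f n).1 + V₂ (splitEquiv q f n).2) (z : ι → ℂ) :
    reindex (splitEquiv q f) (splitEquiv q f) (floquetMatrix q V z) =
      floquetMatrix (fun a => q (f (Sum.inl a))) V₁ (fun a => z (f (Sum.inl a))) ⊗ₖ 1 +
      1 ⊗ₖ floquetMatrix (fun b => q (f (Sum.inr b))) V₂ (fun b => z (f (Sum.inr b))) := by
  ext p s
  obtain ⟨n, rfl⟩ := (splitEquiv q f).surjective p
  obtain ⟨n', rfl⟩ := (splitEquiv q f).surjective s
  rw [reindex_apply, submatrix_apply, Equiv.symm_apply_apply, Equiv.symm_apply_apply, Matrix.add_apply,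
    kroneckerMap_apply, kroneckerMap_apply]
  simp only [floquetMatrix]
  rw [← f.sum_comp, Fintype.sum_sum_type, hV]
  simp only [← (splitEquiv q f).apply_eq_iff_eq (x := n'), splitEquiv_add, splitEquiv_sub,
    splitEquiv_single_inl, splitEquiv_single_inr]
  have hinl (a : κ) : n (f (Sum.inl a)) = (splitEquiv q f n).1 a := rfl
  have hinr (b : κ') : n (f (Sum.inr b)) = (splitEquiv q f n).2 b := rfl
  simp only [hinl, hinr]
  generalize splitEquiv q f n = p
  generalize splitEquiv q f n' = s
  obtain ⟨p₁, p₂⟩ := p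
  obtain ⟨s₁, s₂⟩ := s
  simp only [Prod.mk_add_mk, Prod.mk_sub_mk, Prod.mk.injEq, add_zero, sub_zero, one_apply]
  by_cases h₁ : s₁ = p₁ <;> by_cases h₂ : s₂ = p₂
  · subst h₁ h₂
    simp
    ring
  · simp [h₁, h₂, Ne.symm h₂]
  · simp [h₁, h₂, Ne.symm h₁]
  · simp [h₁, h₂, Ne.symm h₁, Ne.symm h₂]

end Floquet

section Isospectral

variable {ι κ κ' : Type*} [Fintype ι] [DecidableEq ι] [Fintype κ] [DecidableEq κ]
  [Fintype κ'] [DecidableEq κ']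

lemma frequently_ofReal : ∃ᶠ w : ℂ in 𝓝[≠] 0, ∃ t : ℝ, w = t := by
  have h : Tendsto (fun t : ℝ => (t : ℂ)) (𝓝[≠] 0) (𝓝[≠] 0) := by
    refine tendsto_nhdsWithin_of_tendsto_nhds_of_eventually_within _ ?_ ?_
    · simpa using (Complex.continuous_ofReal.tendsto 0).mono_left nhdsWithin_le_nhds
    · filter_upwards [self_mem_nhdsWithin] with t ht
      simpa using ht
  exact h.frequently (Frequently.of_forall fun t => ⟨t, rfl⟩)

lemma differentiable_det {n : Type*} [Fintype n] [DecidableEq n] {A : ℂ → Matrix n n ℂ}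
    (hA : ∀ i j, Differentiable ℂ fun w => A w i j) : Differentiable ℂ fun w => (A w).det := by
  simp only [det_apply]
  fun_prop

/-- The identity of characteristic polynomials extends from real to complex quasimomenta. -/
lemma charpoly_eq_complex (q : ι → ℕ) [∀ i, NeZero (q i)] (V Y : (∀ i, ZMod (q i)) → ℂ)
    (hiso : ∀ k : ι → ℝ,
      (floquetMatrix q V (fun j => Complex.exp (2 * Real.pi * Complex.I * (k j)))).charpoly
      = (floquetMatrix q Y (fun j => Complex.exp (2 * Real.pi * Complex.I * (k j)))).charpoly)
    (p r : ι → ℝ) (w : ℂ) :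
    (floquetMatrix q V
        (fun j => Complex.exp (2 * Real.pi * Complex.I * (p j + r j * w)))).charpoly
      = (floquetMatrix q Y
        (fun j => Complex.exp (2 * Real.pi * Complex.I * (p j + r j * w)))).charpoly := by
  refine Polynomial.funext fun x => ?_
  rw [eval_charpoly, eval_charpoly]
  have han (V : (∀ i, ZMod (q i)) → ℂ) : AnalyticOnNhd ℂ (fun w : ℂ =>
      (scalar _ x - floquetMatrix q V
        (fun j => Complex.exp (2 * Real.pi * Complex.I * (p j + r j * w)))).det) Set.univ := by
    refine DifferentiableOn.analyticOnNhd (Differentiable.differentiableOn ?_) isOpen_univ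
    refine differentiable_det fun n n' => ?_
    simp only [Matrix.sub_apply, floquetMatrix, ← Complex.exp_neg]
    refine Differentiable.const_sub (Differentiable.add_const _ ?_) _
    refine Differentiable.fun_sum fun j _ => Differentiable.add ?_ ?_ <;>
      split_ifs <;> fun_prop
  refine congrFun ((han V).eq_of_frequently_eq (z₀ := 0) (han Y) ?_) w
  refine frequently_ofReal.mono ?_
  rintro w ⟨t, rfl⟩
  have := hiso fun j => p j + r j * t
  simp only [← eval_charpoly]
  push_cast at this
  rw [this]

lemma floquetMatrix_add_const (q : ι → ℕ) [∀ i, NeZero (q i)] (V : (∀ i, ZMod (q i)) → ℂ)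
    (c : ℂ) (z : ι → ℂ) :
    floquetMatrix q (fun n => V n + c) z = floquetMatrix q V z + scalar _ c := by
  ext n n'
  by_cases h : n' = n
  · subst h
    simp [floquetMatrix]
    ring
  · simp [floquetMatrix, h, Ne.symm h]

lemma charpoly_add_scalar_sub {n : Type*} [Fintype n] [DecidableEq n] {A B : Matrix n n ℂ}
    {s t : ℂ} (h : (A + scalar n s).charpoly = (B + scalar n t).charpoly) :
    A.charpoly = (B + scalar n (t - s)).charpoly := by
  refine Polynomial.funext fun x => ?_
  have := congrArg (Polynomial.eval (x + s)) h
  rw [eval_charpoly, eval_charpoly] at this ⊢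
  simp only [map_add, map_sub] at this ⊢
  convert this using 2 <;> abel

/-- If two potentials, each a sum of a potential in the first and a potential in the second group
of coordinates, are isospectral, then so are their first components up to a constant. -/
lemma charpoly_eq_of_split (q : ι → ℕ) [∀ i, NeZero (q i)] (f : κ ⊕ κ' ≃ ι)
    (V Y : (∀ i, ZMod (q i)) → ℂ) (V₁ Y₁ : (∀ a, ZMod (q (f (Sum.inl a)))) → ℂ)
    (V₂ Y₂ : (∀ b, ZMod (q (f (Sum.inr b)))) → ℂ)
    (hV : ∀ n, V n = V₁ (splitEquiv q f n).1 + V₂ (splitEquiv q f n).2)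
    (hY : ∀ n, Y n = Y₁ (splitEquiv q f n).1 + Y₂ (splitEquiv q f n).2)
    (hiso : ∀ k : ι → ℝ,
      (floquetMatrix q V (fun j => Complex.exp (2 * Real.pi * Complex.I * (k j)))).charpoly
      = (floquetMatrix q Y (fun j => Complex.exp (2 * Real.pi * Complex.I * (k j)))).charpoly)
    (k : κ → ℝ) :
    (floquetMatrix (fun a => q (f (Sum.inl a))) V₁
        (fun a => Complex.exp (2 * Real.pi * Complex.I * (k a)))).charpoly
      = (floquetMatrix (fun a => q (f (Sum.inl a))) (fun m => Y₁ m + ((𝔼 n, Y₂ n) - 𝔼 n, V₂ n))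
        (fun a => Complex.exp (2 * Real.pi * Complex.I * (k a)))).charpoly := by
  rw [floquetMatrix_add_const]
  apply charpoly_add_scalar_sub
  let e : (∀ b, ZMod (q (f (Sum.inr b)))) ≃ AddChar (∀ b, ZMod (q (f (Sum.inr b)))) ℂ :=
    Fintype.equivOfCardEq AddChar.card_eq.symm
  have hK (U : (∀ b, ZMod (q (f (Sum.inr b)))) → ℂ) :
      potentialFourierMatrix e U (e.symm 0) (e.symm 0) = 𝔼 n, U n := by
    simp [potentialFourierMatrix]
  rw [← hK V₂, ← hK Y₂]
  refine charpoly_eq_of_kroneckerSum (fun l => ∑ j, e l (Pi.single j 1))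
    (fun l => ∑ j, e l (-Pi.single j 1)) _ (fun l hl h => hl ?_) _ _ _ _ fun u hu => ?_
  · rw [Equiv.eq_symm_apply]
    refine character_eq_zero_of_sum_single _ _ (h.trans ?_)
    simp
  · obtain ⟨w, rfl⟩ : ∃ w : ℂ, Complex.exp (2 * Real.pi * Complex.I * w) = u := by
      refine ⟨Complex.log u / (2 * Real.pi * Complex.I), ?_⟩
      rw [mul_div_cancel₀ _ Complex.two_pi_I_ne_zero, Complex.exp_log hu]
    have key := charpoly_eq_complex q V Y hiso (fun i => Sum.elim k 0 (f.symm i))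
      (fun i => Sum.elim 0 (fun b => (q (f (Sum.inr b)) : ℝ)) (f.symm i)) w
    rw [← charpoly_reindex (splitEquiv q f), ← charpoly_reindex (splitEquiv q f),
      reindex_floquetMatrix q f V V₁ V₂ hV, reindex_floquetMatrix q f Y Y₁ Y₂ hY] at key
    have hpow (b : κ') : Complex.exp (2 * Real.pi * Complex.I * (q (f (Sum.inr b)) * w))
        = Complex.exp (2 * Real.pi * Complex.I * w) ^ q (f (Sum.inr b)) := by
      rw [← Complex.exp_nat_mul]
      congr 1
      ring
    simp only [Equiv.symm_apply_apply, Sum.elim_inl, Sum.elim_inr, Pi.zero_apply,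
      Complex.ofReal_zero, zero_mul, add_zero, zero_add, Complex.ofReal_natCast, hpow] at key
    obtain ⟨L, R, hLR, h⟩ := exists_conj_floquetMatrix _ V₂ e hu
    obtain ⟨L', R', hLR', h'⟩ := exists_conj_floquetMatrix _ Y₂ e hu
    rw [← h, ← h', charpoly_kroneckerSum_conj _ _ _ _ hLR,
      charpoly_kroneckerSum_conj _ _ _ _ hLR', key]

lemma expect_split (q : ι → ℕ) [∀ i, NeZero (q i)] (f : κ ⊕ κ' ≃ ι)
    (V : (∀ i, ZMod (q i)) → ℂ) (V₁ : (∀ a, ZMod (q (f (Sum.inl a)))) → ℂ)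
    (V₂ : (∀ b, ZMod (q (f (Sum.inr b)))) → ℂ)
    (hV : ∀ n, V n = V₁ (splitEquiv q f n).1 + V₂ (splitEquiv q f n).2) :
    (𝔼 n, V n) = (𝔼 n, V₁ n) + 𝔼 n, V₂ n := by
  rw [Fintype.expect_equiv (splitEquiv q f) V (fun p => V₁ p.1 + V₂ p.2) hV,
    ← Finset.univ_product_univ, Finset.expect_product]
  simp only [Finset.expect_add_distrib, Fintype.expect_const]

lemma expect_eq_of_charpoly_eq (q : ι → ℕ) [∀ i, NeZero (q i)] (V Y : (∀ i, ZMod (q i)) → ℂ)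
    (z : ι → ℂ) (h : (floquetMatrix q V z).charpoly = (floquetMatrix q Y z).charpoly) :
    (𝔼 n, V n) = 𝔼 n, Y n := by
  have htr : (floquetMatrix q V z).trace = (floquetMatrix q Y z).trace := by
    rw [trace_eq_neg_charpoly_coeff, trace_eq_neg_charpoly_coeff, h]
  simp only [trace, diag_apply, floquetMatrix, Finset.sum_add_distrib, if_true] at htr
  rw [Fintype.expect_eq_sum_div_card, Fintype.expect_eq_sum_div_card, add_left_cancel htr]

end Isospectral

section Blocks

variable {d r : ℕ} (ds : Fin r → ℕ) (hsum : ∑ m, ds m = d)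

lemma blockOffset_add_le_blockOffset {i j : Fin r} (h : i < j) :
    blockOffset ds i + ds i ≤ blockOffset ds j := by
  have hi : i ∉ Finset.univ.filter (fun m : Fin r => m < i) := by simp
  rw [blockOffset, add_comm, ← Finset.sum_insert hi]
  refine Finset.sum_le_sum_of_subset fun m hm => ?_
  simp only [Finset.mem_insert, Finset.mem_filter_univ] at hm ⊢
  rcases hm with rfl | hm
  · exact h
  · exact hm.trans h

lemma blockEmb_injective (j : Fin r) : Function.Injective (blockEmb ds hsum j) := by
  intro a b h
  have := congrArg Fin.val h
  simp only [blockEmb] at this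
  exact Fin.ext (by omega)

lemma blockEmb_ne_blockEmb {i j : Fin r} (h : i ≠ j) (a : Fin (ds i)) (b : Fin (ds j)) :
    blockEmb ds hsum i a ≠ blockEmb ds hsum j b := by
  intro hab
  have := congrArg Fin.val hab
  simp only [blockEmb] at this
  have ha := a.isLt
  have hb := b.isLt
  rcases lt_or_gt_of_ne h with hij | hij
  · have := blockOffset_add_le_blockOffset ds hij
    omega
  · have := blockOffset_add_le_blockOffset ds hij
    omega

/-- The coordinates split into the `j`-th block and the remaining ones. -/
def blockSplit (j : Fin r) :
    Fin (ds j) ⊕ ((Set.range (blockEmb ds hsum j))ᶜ : Set (Fin d)) ≃ Fin d :=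
  ((Equiv.ofInjective _ (blockEmb_injective ds hsum j)).sumCongr (Equiv.refl _)).trans
    (Equiv.Set.sumCompl _)

/-- A separable potential is the sum of its `j`-th component and a potential depending on the
remaining coordinates. -/
lemma exists_split_of_separable (q : Fin d → ℕ) (j : Fin r)
    (V : (∀ i, ZMod (q i)) → ℂ)
    (Vj : ∀ j : Fin r, ((∀ b : Fin (ds j), ZMod (q (blockEmb ds hsum j b))) → ℂ))
    (hV : ∀ n, V n = ∑ j, Vj j (fun b => n (blockEmb ds hsum j b))) :
    ∃ V₂ : (∀ b, ZMod (q (blockSplit ds hsum j (Sum.inr b)))) → ℂ, ∀ n,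
      V n = Vj j (splitEquiv q (blockSplit ds hsum j) n).1
        + V₂ (splitEquiv q (blockSplit ds hsum j) n).2 := by
  refine ⟨fun m => ∑ i ∈ Finset.univ.erase j, Vj i fun b =>
    (splitEquiv q (blockSplit ds hsum j)).symm (0, m) (blockEmb ds hsum i b), fun n => ?_⟩
  rw [hV, ← Finset.add_sum_erase _ _ (Finset.mem_univ j)]
  congr 1
  refine Finset.sum_congr rfl fun i hi => congrArg _ (funext fun b => ?_)
  have hij : i ≠ j := Finset.ne_of_mem_erase hi
  have hmem : blockEmb ds hsum i b ∈ (Set.range (blockEmb ds hsum j))ᶜ := by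
    rintro ⟨a, ha⟩
    exact blockEmb_ne_blockEmb ds hsum hij b a ha.symm
  have h := congrArg Prod.snd ((splitEquiv q (blockSplit ds hsum j)).apply_symm_apply
    (0, (splitEquiv q (blockSplit ds hsum j) n).2))
  exact (congrFun h ⟨_, hmem⟩).symm

end Blocks

/-- If complex-valued separable Γ-periodic potentials `V = ⊕ Vⱼ` and `Y = ⊕ Yⱼ`
are Floquet isospectral, then up to constants summing to zero the lower dimensional
components `Vⱼ` and `Yⱼ + cⱼ` are Floquet isospectral. -/
theorem stmt1 {d r : ℕ} (hd : 1 ≤ d) (hr : 2 ≤ r)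
    (q : Fin d → ℕ) [∀ i, NeZero (q i)]
    (ds : Fin r → ℕ) (hds : ∀ j, 1 ≤ ds j) (hsum : ∑ m, ds m = d)
    (V Y : (∀ i, ZMod (q i)) → ℂ)
    (Vj : ∀ j : Fin r, ((∀ b : Fin (ds j), ZMod (q (blockEmb ds hsum j b))) → ℂ))
    (Yj : ∀ j : Fin r, ((∀ b : Fin (ds j), ZMod (q (blockEmb ds hsum j b))) → ℂ))
    (hV : ∀ n, V n = ∑ j, Vj j (fun b => n (blockEmb ds hsum j b)))
    (hY : ∀ n, Y n = ∑ j, Yj j (fun b => n (blockEmb ds hsum j b)))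
    (hiso : FloquetIso q V Y) :
    ∃ c : Fin r → ℂ, (∑ j, c j) = 0 ∧
      ∀ j : Fin r, FloquetIso (fun b => q (blockEmb ds hsum j b)) (Vj j)
        (fun m => Yj j m + c j) := by
  have hiso' := hiso
  simp only [FloquetIso, floquetMat_eq_floquetMatrix] at hiso'
  have hmean : (𝔼 n, V n) = 𝔼 n, Y n := expect_eq_of_charpoly_eq q V Y _ (hiso' 0)
  have hcomp (U : ∀ j : Fin r, ((∀ b : Fin (ds j), ZMod (q (blockEmb ds hsum j b))) → ℂ))
      (j : Fin r) : (𝔼 n : ∀ i, ZMod (q i), U j (fun b => n (blockEmb ds hsum j b)))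
        = 𝔼 m, U j m := by
    refine (expect_split q (blockSplit ds hsum j) _ (U j) 0 fun n => ?_).trans ?_
    · rw [Pi.zero_apply, add_zero]
      rfl
    · simp only [Pi.zero_apply, Finset.expect_const_zero, add_zero]
      rfl
  refine ⟨fun j => (𝔼 m, Vj j m) - 𝔼 m, Yj j m, ?_, fun j => ?_⟩
  · rw [Finset.sum_sub_distrib, sub_eq_zero]
    simp only [← hcomp, ← Finset.expect_sum_comm, ← hV, ← hY, hmean]
  · obtain ⟨V₂, hV₂⟩ := exists_split_of_separable ds hsum q j V Vj hV
    obtain ⟨Y₂, hY₂⟩ := exists_split_of_separable ds hsum q j Y Yj hY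
    have hc : (𝔼 n, Y₂ n) - (𝔼 n, V₂ n) = (𝔼 m, Vj j m) - 𝔼 m, Yj j m := by
      have h₁ : (𝔼 n, V n) = (𝔼 m, Vj j m) + 𝔼 n, V₂ n :=
        expect_split q (blockSplit ds hsum j) V (Vj j) V₂ hV₂
      have h₂ : (𝔼 n, Y n) = (𝔼 m, Yj j m) + 𝔼 n, Y₂ n :=
        expect_split q (blockSplit ds hsum j) Y (Yj j) Y₂ hY₂
      linear_combination h₁ - h₂ - hmean
    intro k
    have h := charpoly_eq_of_split q (blockSplit ds hsum j) V Y (Vj j) (Yj j) V₂ Y₂ hV₂ hY₂ hiso' k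
    rw [hc] at h
    exact h

end DPSO
end
end

section
/- Let V, Y : W → ℝ be real-valued Γ-periodic potentials that are Floquet isospectral. Then for every λ ∈ ℂ and every z = (z₁,…,z_d) ∈ ℂ^d such that −λ + Σ_{j=1}^d ρ^j_{n_j} z_j ≠ 0 for all n ∈ W, one has Σ_{n∈W} Σ_{n′∈W} |V̂(n−n′)|² / ( (−λ + Σ_{j=1}^d ρ^j_{n_j} z_j)·(−λ + Σ_{j=1}^d ρ^j_{n′_j} z_j) ) = Σ_{n∈W} Σ_{n′∈W} |Ŷ(n−n′)|² / ( (−λ + Σ_{j=1}^d ρ^j_{n_j} z_j)·(−λ + Σ_{j=1}^d ρ^j_{n′_j} z_j) ). -/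
open scoped BigOperators

noncomputable section

namespace DPSO

open Matrix Polynomial in
/-- If `det (1 + s M + s² N)` and `det (1 + s M' + s² N)` agree for all `s ≠ 0`, then
`M ^ 2` and `M' ^ 2` have the same trace. -/
lemma trace_sq_eq_of_det_eq {ι : Type*} [Fintype ι] [DecidableEq ι] (M M' N : Matrix ι ι ℂ)
    (h : ∀ s : ℂ, s ≠ 0 → (1 + s • M + s ^ 2 • N).det = (1 + s • M' + s ^ 2 • N).det) :
    (M * M).trace = (M' * M').trace := by
  let K : Matrix ι ι ℂ → Matrix ι ι ℂ[X] := fun A =>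
    C.mapMatrix (2 • N - A * A) + (X : ℂ[X]) • C.mapMatrix (A * N - N * A)
      + (X : ℂ[X]) ^ 2 • C.mapMatrix (N * N)
  have hK : ∀ A s, (evalRingHom s).mapMatrix (1 + (X : ℂ[X]) ^ 2 • K A)
      = (1 + s • A + s ^ 2 • N) * (1 + (-s) • A + (-s) ^ 2 • N) := by
    intro A s
    have : (evalRingHom s).mapMatrix (1 + (X : ℂ[X]) ^ 2 • K A)
        = 1 + s ^ 2 • ((2 • N - A * A) + s • (A * N - N * A) + s ^ 2 • (N * N)) := by
      simp only [K]
      generalize 2 • N - A * A = P₀, A * N - N * A = P₁, N * N = P₂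
      ext i j
      by_cases hij : i = j <;> simp [hij] <;> ring
    rw [this]
    simp only [mul_add, add_mul, smul_add, smul_sub, mul_one, one_mul, smul_mul_assoc,
      mul_smul_comm, smul_smul]
    module
  have hdet : (1 + (X : ℂ[X]) ^ 2 • K M).det = (1 + (X : ℂ[X]) ^ 2 • K M').det := by
    refine Polynomial.eq_of_infinite_eval_eq _ _ ((Set.finite_singleton (0 : ℂ)).infinite_compl.mono
      fun s hs => ?_)
    have hs : s ≠ 0 := hs
    have key : ∀ A, ((1 + (X : ℂ[X]) ^ 2 • K A).det).eval s
        = (1 + s • A + s ^ 2 • N).det * (1 + (-s) • A + (-s) ^ 2 • N).det := by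
      intro A
      rw [← coe_evalRingHom, RingHom.map_det, hK, det_mul]
    show eval s _ = eval s _
    rw [key, key, h s hs, h (-s) (neg_ne_zero.2 hs)]
  have hexp : ∀ A, ∃ R : ℂ[X], (1 + (X : ℂ[X]) ^ 2 • K A).det
      = 1 + (K A).trace * X ^ 2 + R * (X ^ 2) ^ 2 := fun A => ⟨_, det_one_add_smul _ _⟩
  obtain ⟨R, hR⟩ := hexp M
  obtain ⟨R', hR'⟩ := hexp M'
  have h0 : (X : ℂ[X]) ^ 2 * ((K M).trace + R * X ^ 2) = X ^ 2 * ((K M').trace + R' * X ^ 2) := by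
    linear_combination hdet - hR + hR'
  have h1 := congrArg (eval 0) (mul_left_cancel₀ (pow_ne_zero 2 X_ne_zero) h0)
  simp only [eval_add, eval_mul, eval_pow, eval_X] at h1
  have h2 : ∀ A, eval 0 (K A).trace = (2 • N - A * A).trace := by
    intro A
    simp [K, Matrix.trace, eval_finsetSum]
  rw [h2, h2] at h1
  simpa [trace_sub] using h1

/-- The character pairing `(l, n) ↦ exp (2πi ∑ l_j n_j / q_j)` on the finite group `W`. -/
def pairing {d : ℕ} (q : Fin d → ℕ) [∀ i, NeZero (q i)] (l n : ∀ i, ZMod (q i)) : ℂ :=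
  ∏ j, ZMod.stdAddChar (l j * n j)

section Pairing

variable {d : ℕ} (q : Fin d → ℕ) [∀ i, NeZero (q i)]

lemma pairing_add_left (l l' n : ∀ i, ZMod (q i)) :
    pairing q (l + l') n = pairing q l n * pairing q l' n := by
  simp [pairing, add_mul, AddChar.map_add_eq_mul, Finset.prod_mul_distrib]

lemma pairing_comm (l n : ∀ i, ZMod (q i)) : pairing q l n = pairing q n l := by
  simp [pairing, mul_comm]

lemma pairing_neg_left (l n : ∀ i, ZMod (q i)) :
    pairing q (-l) n = (starRingEnd ℂ) (pairing q l n) := by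
  simp [pairing, AddChar.map_neg_eq_conj]

lemma pairing_add_single (l n : ∀ i, ZMod (q i)) (j : Fin d) :
    pairing q l (n + Pi.single j 1) = ZMod.stdAddChar (l j) * pairing q l n := by
  have h : ∀ i, ZMod.stdAddChar (l i * (n + Pi.single j 1 : ∀ i, ZMod (q i)) i)
      = (if i = j then ZMod.stdAddChar (l i) else 1) * ZMod.stdAddChar (l i * n i) := by
    intro i
    rcases eq_or_ne i j with rfl | hij
    · simp [mul_add, AddChar.map_add_eq_mul, mul_comm]
    · simp [hij]
  simp only [pairing, h, Finset.prod_mul_distrib, Finset.prod_ite_eq', Finset.mem_univ, if_true]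

lemma sum_pairing (l : ∀ i, ZMod (q i)) :
    ∑ n, pairing q l n = if l = 0 then ∏ i, (q i : ℂ) else 0 := by
  have h : ∑ n, pairing q l n = ∏ i, ∑ x : ZMod (q i), ZMod.stdAddChar (l i * x) := by
    rw [Finset.prod_univ_sum, Fintype.piFinset_univ]
    rfl
  rw [h]
  simp_rw [mul_comm (l _), AddChar.sum_mulShift _ (ZMod.isPrimitive_stdAddChar _), ZMod.card]
  split_ifs with hl
  · simp [hl]
  · obtain ⟨i, hi⟩ := Function.ne_iff.1 hl
    exact Finset.prod_eq_zero (Finset.mem_univ i) (by simp [show l i ≠ 0 from hi])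

lemma rho_val (j : Fin d) (x : ZMod (q j)) : rho q j x.val = ZMod.stdAddChar x := by
  rw [ZMod.stdAddChar_apply, ZMod.toCircle_apply, rho]

lemma prod_period_ne_zero : (∏ i, (q i : ℂ)) ≠ 0 :=
  Finset.prod_ne_zero_iff.2 fun i _ => Nat.cast_ne_zero.2 (NeZero.ne (q i))

lemma pairing_eq_exp (l n : ∀ i, ZMod (q i)) :
    pairing q l n = Complex.exp ((2 * Real.pi * Complex.I) *
      ∑ j, ((l j).val : ℂ) * ((n j).val : ℂ) / (q j : ℂ)) := by
  rw [Finset.mul_sum, Complex.exp_sum]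
  refine Finset.prod_congr rfl fun j _ => ?_
  have h := ZMod.stdAddChar_coe (N := q j) (((l j).val * (n j).val : ℕ) : ℤ)
  push_cast at h
  rw [ZMod.natCast_zmod_val, ZMod.natCast_zmod_val] at h
  rw [h]
  congr 1
  ring

lemma dft_eq_sum_pairing (V : (∀ i, ZMod (q i)) → ℂ) (l : ∀ i, ZMod (q i)) :
    dft q V l = (∏ i, (q i : ℂ))⁻¹ * ∑ n, V n * pairing q (-l) n := by
  rw [dft, one_div]
  congr 1
  refine Finset.sum_congr rfl fun n _ => ?_
  rw [pairing_neg_left, pairing_eq_exp, ← Complex.exp_conj]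
  congr 2
  simp only [map_mul, map_sum, map_div₀, Complex.conj_natCast, Complex.conj_I, Complex.conj_ofReal,
    map_ofNat]
  ring

/-- Fourier inversion on `W`. -/
lemma sum_dft_mul_pairing (V : (∀ i, ZMod (q i)) → ℂ) (n : ∀ i, ZMod (q i)) :
    ∑ k, dft q V k * pairing q k n = V n := by
  have h : ∀ k m : ∀ i, ZMod (q i),
      pairing q (-k) m * pairing q k n = pairing q (n - m) k := by
    intro k m
    rw [sub_eq_add_neg, pairing_add_left, pairing_neg_left, pairing_neg_left, pairing_comm q m k,
      pairing_comm q n k, mul_comm]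
  simp_rw [dft_eq_sum_pairing, mul_assoc, Finset.sum_mul, ← Finset.mul_sum]
  rw [Finset.sum_comm]
  simp_rw [mul_assoc, h, ← Finset.mul_sum, sum_pairing, sub_eq_zero]
  simp [prod_period_ne_zero, mul_comm]

lemma dft_neg_of_real (V : (∀ i, ZMod (q i)) → ℝ) (l : ∀ i, ZMod (q i)) :
    dft q (fun m => (V m : ℂ)) (-l) = (starRingEnd ℂ) (dft q (fun m => (V m : ℂ)) l) := by
  simp [dft_eq_sum_pairing, pairing_neg_left, map_sum]

lemma normSq_dft_of_real (V : (∀ i, ZMod (q i)) → ℝ) (n n' : ∀ i, ZMod (q i)) :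
    (Complex.normSq (dft q (fun m => (V m : ℂ)) (n - n')) : ℂ)
      = matB q (fun m => (V m : ℂ)) n n' * matB q (fun m => (V m : ℂ)) n' n := by
  rw [matB, matB, ← neg_sub n n', dft_neg_of_real, Complex.mul_conj]

end Pairing

lemma rho_ne_zero {d : ℕ} (q : Fin d → ℕ) (j : Fin d) (m : ℕ) : rho q j m ≠ 0 :=
  Complex.exp_ne_zero _

section FloquetTransform

variable {d : ℕ} (q : Fin d → ℕ) [∀ i, NeZero (q i)]

lemma boundary_mul_pow_val_add_one {N : ℕ} [NeZero N] (a : ZMod N) (z : ℂ) :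
    (if a.val = N - 1 then z ^ N else 1) * z ^ (a + 1).val = z * z ^ a.val := by
  have hN : 0 < N := NeZero.pos N
  have ha := ZMod.val_lt a
  have hval : (a + 1).val = (a.val + 1) % N := by
    rw [ZMod.val_add, ZMod.val_one_eq_one_mod, Nat.add_mod_mod]
  rw [hval]
  split_ifs with h
  · rw [h, Nat.sub_add_cancel hN, Nat.mod_self, pow_zero, mul_one, ← pow_succ',
      Nat.sub_add_cancel hN]
  · rw [Nat.mod_eq_of_lt (by omega), one_mul, pow_succ']

lemma val_sub_one_eq_iff {N : ℕ} [NeZero N] (a : ZMod N) : (a - 1).val = N - 1 ↔ a.val = 0 := by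
  have hN : 0 < N := NeZero.pos N
  have hval : a.val = ((a - 1).val + 1) % N := by
    conv_lhs => rw [← sub_add_cancel a 1]
    rw [ZMod.val_add, ZMod.val_one_eq_one_mod, Nat.add_mod_mod]
  have hlt := ZMod.val_lt (a - 1)
  constructor
  · intro h
    rw [hval, h, Nat.sub_add_cancel hN, Nat.mod_self]
  · intro h
    by_contra hne
    rw [hval, Nat.mod_eq_of_lt (by omega)] at h
    omega

/-- The Floquet–Bloch waves `ψ_l(n) = ∏_j (ρ^j_{l_j} z_j)^{n_j}`, as the columns of a matrix. -/
def blochMat (z : Fin d → ℂ) : Matrix (∀ i, ZMod (q i)) (∀ i, ZMod (q i)) ℂ :=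
  fun n l => (∏ i, z i ^ (n i).val) * pairing q l n

lemma blochMat_add_single (z : Fin d → ℂ) (n l : ∀ i, ZMod (q i)) (j : Fin d) :
    (if (n j).val = q j - 1 then z j ^ q j else 1) * blochMat q z (n + Pi.single j 1) l
      = rho q j (l j).val * z j * blochMat q z n l := by
  have h : (if (n j).val = q j - 1 then z j ^ q j else 1)
      * ∏ i, z i ^ ((n + Pi.single j 1 : ∀ i, ZMod (q i)) i).val = z j * ∏ i, z i ^ (n i).val := by
    rw [← Finset.mul_prod_erase _ _ (Finset.mem_univ j),
      ← Finset.mul_prod_erase _ (fun i => z i ^ (n i).val) (Finset.mem_univ j), ← mul_assoc,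
      ← mul_assoc]
    congr 1
    · simpa using boundary_mul_pow_val_add_one (n j) (z j)
    · refine Finset.prod_congr rfl fun i hi => ?_
      simp [Finset.ne_of_mem_erase hi]
  rw [blochMat, blochMat, pairing_add_single, rho_val]
  linear_combination (ZMod.stdAddChar (l j) * pairing q l n) * h

lemma blochMat_sub_single (z : Fin d → ℂ) (hz : ∀ j, z j ≠ 0) (n l : ∀ i, ZMod (q i))
    (j : Fin d) :
    (if (n j).val = 0 then (z j ^ q j)⁻¹ else 1) * blochMat q z (n - Pi.single j 1) l
      = (rho q j (l j).val * z j)⁻¹ * blochMat q z n l := by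
  have h := blochMat_add_single q z (n - Pi.single j 1) l j
  rw [sub_add_cancel] at h
  have hb : ((n - Pi.single j 1 : ∀ i, ZMod (q i)) j).val = q j - 1 ↔ (n j).val = 0 := by
    simpa using val_sub_one_eq_iff (n j)
  simp only [hb] at h
  have h1 := hz j
  have h2 := rho_ne_zero q j (l j).val
  split_ifs at h ⊢
  · field_simp
    linear_combination -h
  · field_simp
    linear_combination -h

/-- In the Bloch basis the Floquet matrix becomes `A(z) + B_V`. -/
lemma floquetMat_mul_blochMat (V : (∀ i, ZMod (q i)) → ℂ) (z : Fin d → ℂ) (hz : ∀ j, z j ≠ 0) :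
    floquetMat q V (fun j => z j ^ q j) * blochMat q z
      = blochMat q z * (diagA q z + matB q V) := by
  ext n l
  have hfree : (floquetMat q V (fun j => z j ^ q j) * blochMat q z) n l
      = (∑ j, (rho q j (l j).val * z j + (rho q j (l j).val * z j)⁻¹)) * blochMat q z n l
        + V n * blochMat q z n l := by
    simp only [Matrix.mul_apply, floquetMat, add_mul, Finset.sum_mul, Finset.sum_add_distrib]
    rw [Finset.sum_comm, Finset.sum_comm (s := Finset.univ (α := ∀ i, ZMod (q i)))]
    simp only [← blochMat_add_single, ← blochMat_sub_single q z hz, ite_mul, zero_mul,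
      Finset.sum_ite_eq', Finset.mem_univ, if_true]
  have hpot : V n * blochMat q z n l = (blochMat q z * matB q V) n l := by
    rw [← sum_dft_mul_pairing q V n, Matrix.mul_apply, Finset.sum_mul]
    refine Fintype.sum_equiv (Equiv.addRight l) _ _ fun k => ?_
    simp only [Equiv.coe_addRight, blochMat, matB, add_sub_cancel_right, pairing_add_left]
    ring
  rw [hfree, hpot, mul_add, Matrix.add_apply, diagA, Matrix.mul_diagonal, mul_comm]

lemma isUnit_blochMat (z : Fin d → ℂ) (hz : ∀ j, z j ≠ 0) : IsUnit (blochMat q z) := by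
  have h : blochMat q z = Matrix.diagonal (fun n => ∏ i, z i ^ (n i).val)
      * Matrix.of (fun n l => pairing q l n) := by
    ext n l
    simp [blochMat, Matrix.diagonal_mul]
  have h1 : IsUnit (Matrix.diagonal (fun n : ∀ i, ZMod (q i) => ∏ i, z i ^ (n i).val)) := by
    rw [Matrix.isUnit_diagonal, Pi.isUnit_iff]
    intro n
    exact isUnit_iff_ne_zero.2 (Finset.prod_ne_zero_iff.2 fun i _ => pow_ne_zero _ (hz i))
  have h2 : Matrix.of (fun n l => pairing q l n)
      * ((∏ i, (q i : ℂ))⁻¹ • Matrix.of (fun l n => pairing q (-n) l)) = 1 := by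
    ext n m
    have : ∀ k, pairing q k n * pairing q (-m) k = pairing q (n - m) k := by
      intro k
      rw [sub_eq_add_neg, pairing_add_left, pairing_comm q k n]
    rw [mul_smul_comm, Matrix.smul_apply, Matrix.mul_apply, Matrix.one_apply]
    simp only [Matrix.of_apply, this, sum_pairing, sub_eq_zero, smul_eq_mul]
    split_ifs <;> simp [prod_period_ne_zero]
  rw [h]
  exact h1.mul (IsUnit.of_mul_eq_one _ h2)

lemma charpoly_floquetMat (V : (∀ i, ZMod (q i)) → ℂ) (z : Fin d → ℂ) (hz : ∀ j, z j ≠ 0) :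
    (floquetMat q V (fun j => z j ^ q j)).charpoly = (diagA q z + matB q V).charpoly := by
  obtain ⟨U, hU⟩ := isUnit_blochMat q z hz
  have h := floquetMat_mul_blochMat q V z hz
  rw [← hU, ← Units.eq_mul_inv_iff_mul_eq] at h
  rw [h, Matrix.coe_units_inv, Matrix.charpoly_units_conj]

end FloquetTransform

lemma infinite_range_exp_mul_I : (Set.range fun θ : ℝ => Complex.exp (θ * Complex.I)).Infinite := by
  refine ((Set.Icc_infinite Real.pi_pos).image (f := fun θ : ℝ => Complex.exp (θ * Complex.I))
    fun a ha b hb hab => ?_).mono (Set.image_subset_range _ _)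
  have := congrArg Complex.re hab
  simp only [Complex.exp_ofReal_mul_I_re] at this
  exact Real.injOn_cos ha hb this

section Isospectral

variable {d : ℕ} (q : Fin d → ℕ) [∀ i, NeZero (q i)]

open MvPolynomial in
/-- `(∏ z_j) (x - A(z) - B_V)`, whose entries are polynomials in `z`. -/
def clearedMat (V : (∀ i, ZMod (q i)) → ℂ) (x : ℂ) :
    Matrix (∀ i, ZMod (q i)) (∀ i, ZMod (q i)) (MvPolynomial (Fin d) ℂ) :=
  (∏ i, (X i : MvPolynomial (Fin d) ℂ)) • (Matrix.scalar _ (C x) - (matB q V).map C)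
    - Matrix.diagonal (fun n => ∑ j, (C (rho q j (n j).val) * X j * ∏ i, X i
        + C (rho q j (n j).val)⁻¹ * ∏ i ∈ Finset.univ.erase j, X i))

lemma eval_det_clearedMat (V : (∀ i, ZMod (q i)) → ℂ) (x : ℂ) (z : Fin d → ℂ)
    (hz : ∀ j, z j ≠ 0) :
    MvPolynomial.eval z (clearedMat q V x).det
      = (∏ i, z i) ^ Fintype.card (∀ i, ZMod (q i))
        * (Matrix.scalar _ x - (diagA q z + matB q V)).det := by
  rw [RingHom.map_det, ← Matrix.det_smul]
  congr 1
  have hinv : ∀ (n : ∀ i, ZMod (q i)) j, (rho q j (n j).val)⁻¹ * ∏ i ∈ Finset.univ.erase j, z i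
      = (∏ i, z i) * (rho q j (n j).val * z j)⁻¹ := by
    intro n j
    rw [← Finset.mul_prod_erase _ _ (Finset.mem_univ j)]
    have := hz j
    have := rho_ne_zero q j (n j).val
    field_simp
  have hdiag : ∀ n : ∀ i, ZMod (q i), ∑ j, (rho q j (n j).val * z j * ∏ i, z i
        + (rho q j (n j).val)⁻¹ * ∏ i ∈ Finset.univ.erase j, z i)
      = (∏ i, z i) * ∑ j, (rho q j (n j).val * z j + (rho q j (n j).val * z j)⁻¹) := by
    intro n
    rw [Finset.mul_sum]
    refine Finset.sum_congr rfl fun j _ => ?_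
    rw [hinv]
    ring
  ext n n'
  by_cases h : n = n'
  · subst h
    simp only [clearedMat, diagA, RingHom.mapMatrix_apply, Matrix.map_apply, Matrix.sub_apply,
      Matrix.add_apply, Matrix.smul_apply, Matrix.scalar_apply, Matrix.diagonal_apply_eq,
      smul_eq_mul, map_sub, map_mul, map_sum, map_add, map_prod, MvPolynomial.eval_C,
      MvPolynomial.eval_X, hdiag]
    ring
  · simp [clearedMat, diagA, h]

lemma FloquetIso.det_eq {V Y : (∀ i, ZMod (q i)) → ℂ} (hiso : FloquetIso q V Y) (x : ℂ)
    (z : Fin d → ℂ) (hz : ∀ j, z j ≠ 0) :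
    (Matrix.scalar _ x - (diagA q z + matB q V)).det
      = (Matrix.scalar _ x - (diagA q z + matB q Y)).det := by
  have hpoly : (clearedMat q V x).det = (clearedMat q Y x).det := by
    refine MvPolynomial.funext_set (fun _ => Set.range fun θ : ℝ => Complex.exp (θ * Complex.I))
      (fun _ => infinite_range_exp_mul_I) fun w hw => ?_
    choose θ hθ using fun j => hw j (Set.mem_univ j)
    have hw0 : ∀ j, w j ≠ 0 := fun j => hθ j ▸ Complex.exp_ne_zero _
    have hk := hiso fun j => q j * θ j / (2 * Real.pi)
    have hexp : (fun j => Complex.exp (2 * Real.pi * Complex.I *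
        ((q j * θ j / (2 * Real.pi) : ℝ) : ℂ))) = fun j => w j ^ q j := by
      funext j
      rw [← hθ j, ← Complex.exp_nat_mul]
      congr 1
      have : (Real.pi : ℂ) ≠ 0 := Complex.ofReal_ne_zero.2 Real.pi_ne_zero
      push_cast
      field_simp
    rw [hexp, charpoly_floquetMat q V w hw0, charpoly_floquetMat q Y w hw0] at hk
    rw [eval_det_clearedMat q V x w hw0, eval_det_clearedMat q Y x w hw0, ← Matrix.eval_charpoly,
      ← Matrix.eval_charpoly, hk]
  have h := congrArg (MvPolynomial.eval z) hpoly
  rw [eval_det_clearedMat q V x z hz, eval_det_clearedMat q Y x z hz] at h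
  exact mul_left_cancel₀ (pow_ne_zero _ (Finset.prod_ne_zero_iff.2 fun i _ => hz i)) h

lemma scalar_sub_eq_smul_diagonal_mul (B : Matrix (∀ i, ZMod (q i)) (∀ i, ZMod (q i)) ℂ) (lam : ℂ)
    (z : Fin d → ℂ) (E : (∀ i, ZMod (q i)) → ℂ)
    (hE : ∀ n, E n = -lam + ∑ j, rho q j (n j).val * z j) (hE0 : ∀ n, E n ≠ 0)
    (s : ℂ) (hs : s ≠ 0) :
    Matrix.scalar _ (s⁻¹ * lam) - (diagA q (fun j => s⁻¹ * z j) + B)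
      = (-s⁻¹) • (Matrix.diagonal E * (1 + s • (Matrix.diagonal (fun n => (E n)⁻¹) * B)
        + s ^ 2 • Matrix.diagonal
          (fun n => (E n)⁻¹ * ∑ j, (rho q j (n j).val * z j)⁻¹))) := by
  have hdiag : Matrix.diagonal E * Matrix.diagonal (fun n => (E n)⁻¹) = 1 := by
    rw [Matrix.diagonal_mul_diagonal, ← Matrix.diagonal_one]
    congr 1
    funext n
    exact mul_inv_cancel₀ (hE0 n)
  rw [mul_add, mul_add, mul_one, mul_smul_comm, mul_smul_comm, ← mul_assoc, hdiag, one_mul,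
    Matrix.diagonal_mul_diagonal]
  have hA : ∀ n : ∀ i, ZMod (q i),
      ∑ j, (rho q j (n j).val * (s⁻¹ * z j) + (rho q j (n j).val * (s⁻¹ * z j))⁻¹)
        = s⁻¹ * (E n + lam) + s * ∑ j, (rho q j (n j).val * z j)⁻¹ := by
    intro n
    rw [hE, neg_add_cancel_comm, Finset.sum_add_distrib, Finset.mul_sum, Finset.mul_sum]
    congr 1 <;> refine Finset.sum_congr rfl fun j _ => ?_
    · ring
    · simp only [mul_inv, inv_inv]
      ring
  ext n n'
  by_cases h : n = n'
  · subst h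
    have h0 := hE0 n
    simp only [diagA, Matrix.sub_apply, Matrix.scalar_apply, Matrix.add_apply,
      Matrix.diagonal_apply_eq, Matrix.smul_apply, hA, smul_eq_mul]
    field_simp
    ring
  · simp [diagA, h, hs]

/-- The Fourier double sum `∑ V̂(n-n') V̂(n'-n) / (E n * E n')` is an isospectral invariant
at every `z` with nonzero coordinates. -/
lemma sum_matB_mul_matB_eq {V Y : (∀ i, ZMod (q i)) → ℂ} (hiso : FloquetIso q V Y) (lam : ℂ)
    (z : Fin d → ℂ) (hz : ∀ j, z j ≠ 0)
    (hne : ∀ n : ∀ i, ZMod (q i), (-lam + ∑ j, rho q j ((n j).val) * z j) ≠ 0) :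
    ∑ n, ∑ n', matB q V n n' * matB q V n' n /
        ((-lam + ∑ j, rho q j ((n j).val) * z j) * (-lam + ∑ j, rho q j ((n' j).val) * z j))
      = ∑ n, ∑ n', matB q Y n n' * matB q Y n' n /
        ((-lam + ∑ j, rho q j ((n j).val) * z j)
          * (-lam + ∑ j, rho q j ((n' j).val) * z j)) := by
  obtain ⟨E, hE⟩ : ∃ E : (∀ i, ZMod (q i)) → ℂ, ∀ n, E n = -lam + ∑ j, rho q j (n j).val * z j :=
    ⟨_, fun _ => rfl⟩
  simp only [← hE] at hne ⊢
  have htr : ∀ B : Matrix (∀ i, ZMod (q i)) (∀ i, ZMod (q i)) ℂ,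
      ((Matrix.diagonal (fun n => (E n)⁻¹) * B) * (Matrix.diagonal (fun n => (E n)⁻¹) * B)).trace
        = ∑ n, ∑ n', B n n' * B n' n / (E n * E n') := by
    intro B
    refine Finset.sum_congr rfl fun n _ => ?_
    rw [Matrix.diag_apply, Matrix.mul_apply]
    refine Finset.sum_congr rfl fun n' _ => ?_
    rw [Matrix.diagonal_mul, Matrix.diagonal_mul, div_eq_mul_inv, mul_inv]
    ring
  rw [← htr, ← htr]
  refine trace_sq_eq_of_det_eq _ _
    (Matrix.diagonal (fun n => (E n)⁻¹ * ∑ j, (rho q j (n j).val * z j)⁻¹)) fun s hs => ?_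
  have h := hiso.det_eq q (s⁻¹ * lam) (fun j => s⁻¹ * z j)
    fun j => mul_ne_zero (inv_ne_zero hs) (hz j)
  rw [scalar_sub_eq_smul_diagonal_mul q _ lam z E hE hne s hs,
    scalar_sub_eq_smul_diagonal_mul q _ lam z E hE hne s hs, Matrix.det_smul, Matrix.det_smul,
    Matrix.det_mul, Matrix.det_mul, Matrix.det_diagonal] at h
  exact mul_left_cancel₀ (Finset.prod_ne_zero_iff.2 fun n _ => hne n)
    (mul_left_cancel₀ (pow_ne_zero _ (neg_ne_zero.2 (inv_ne_zero hs))) h)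

end Isospectral

/-- For real-valued Floquet isospectral potentials `V, Y`, the double sums
`Σ_{n,n'} |V̂(n−n')|² / ((−λ+Σ_j ρ^j_{n_j} z_j)(−λ+Σ_j ρ^j_{n'_j} z_j))` agree for `V` and `Y`
whenever all denominators are nonzero. -/
theorem stmt8 {d : ℕ} (hd : 1 ≤ d) (q : Fin d → ℕ) [∀ i, NeZero (q i)]
    (V Y : (∀ i, ZMod (q i)) → ℝ)
    (hiso : FloquetIso q (fun n => (V n : ℂ)) (fun n => (Y n : ℂ))) :
    ∀ (lam : ℂ) (z : Fin d → ℂ),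
      (∀ n : ∀ i, ZMod (q i), (-lam + ∑ j, rho q j ((n j).val) * z j) ≠ 0) →
      (∑ n : ∀ i, ZMod (q i), ∑ n' : ∀ i, ZMod (q i),
          ((Complex.normSq (dft q (fun m => (V m : ℂ)) (n - n')) : ℂ) /
            ((-lam + ∑ j, rho q j ((n j).val) * z j)
              * (-lam + ∑ j, rho q j ((n' j).val) * z j))))
        = ∑ n : ∀ i, ZMod (q i), ∑ n' : ∀ i, ZMod (q i),
            ((Complex.normSq (dft q (fun m => (Y m : ℂ)) (n - n')) : ℂ) /
              ((-lam + ∑ j, rho q j ((n j).val) * z j)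
                * (-lam + ∑ j, rho q j ((n' j).val) * z j))) := by
  intro lam z hne
  simp only [normSq_dft_of_real]
  let den : ℂ → (∀ i, ZMod (q i)) → ℂ := fun ε n => -lam + ∑ j, rho q j (n j).val * (z j + ε)
  have hden : ∀ n, Continuous fun ε => den ε n := fun n => by fun_prop
  have hden0 : ∀ n, den 0 n ≠ 0 := fun n => by simpa [den] using hne n
  have hlim : ∀ B : Matrix (∀ i, ZMod (q i)) (∀ i, ZMod (q i)) ℂ,
      Filter.Tendsto (fun ε => ∑ n, ∑ n', B n n' * B n' n / (den ε n * den ε n'))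
        (nhdsWithin 0 {0}ᶜ) (nhds (∑ n, ∑ n', B n n' * B n' n / (den 0 n * den 0 n'))) :=
    fun B => tendsto_finsetSum _ fun n _ => tendsto_finsetSum _ fun n' _ =>
      ((continuousAt_const.div ((hden n).mul (hden n')).continuousAt
        (mul_ne_zero (hden0 n) (hden0 n'))).tendsto).mono_left nhdsWithin_le_nhds
  have hz : ∀ᶠ ε in nhdsWithin (0 : ℂ) {0}ᶜ, ∀ j, z j + ε ≠ 0 := by
    refine Filter.eventually_all.2 fun j => ?_
    rcases eq_or_ne (z j) 0 with h | h
    · filter_upwards [self_mem_nhdsWithin] with ε hε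
      simpa [h] using hε
    · exact nhdsWithin_le_nhds
        ((continuous_const.add continuous_id).continuousAt.eventually_ne (by simpa using h))
  have hev : ∀ᶠ ε in nhdsWithin (0 : ℂ) {0}ᶜ, ∀ n, den ε n ≠ 0 :=
    Filter.eventually_all.2 fun n =>
      nhdsWithin_le_nhds ((hden n).continuousAt.eventually_ne (hden0 n))
  have key := tendsto_nhds_unique_of_eventuallyEq (hlim (matB q fun n => (V n : ℂ)))
    (hlim (matB q fun n => (Y n : ℂ))) (by
      filter_upwards [hz, hev] with ε h1 h2
      exact sum_matB_mul_matB_eq q hiso lam (fun j => z j + ε) h1 h2)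
  simpa only [den, add_zero] using key

end DPSO
end
end
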